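/- arXiv:1907.08762 — 2 statements merged into one kernel-verified Lean document; each statement's English description precedes it below -/
import Mathlib

section
/- Ps-Tychonoffness is hereditary: every subspace (with the subspace topology) of a Ps-Tychonoff topological space is Ps-Tychonoff. -/
open Set Topology Filter

universe u v

/-- A subset `K` of a topological space is pseudocompact if every continuous
real-valued function on `K` (with the subspace topology) is bounded. -/
def IsPseudocompactSet {X : Type u} [TopologicalSpace X] (K : Set X) : Prop :=
  ∀ f : K → ℝ, Continuous f → ∃ M : ℝ, ∀ x : K, |f x| ≤ M

/-- A subset `K` is countably compact if every countable open cover of `K`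
has a finite subcover. -/
def IsCountablyCompactSet {X : Type u} [TopologicalSpace X] (K : Set X) : Prop :=
  ∀ U : ℕ → Set X, (∀ n, IsOpen (U n)) → K ⊆ ⋃ n, U n →
    ∃ t : Finset ℕ, K ⊆ ⋃ n ∈ t, U n

/-- `f` restricts to a homeomorphism of `K` onto `f '' K`
(both with their subspace topologies). -/
def RestrictsToHomeo {X : Type u} {Y : Type v} [TopologicalSpace X] [TopologicalSpace Y]
    (f : X → Y) (K : Set X) : Prop :=
  ∃ e : K ≃ₜ (f '' K), ∀ x : K, (e x : Y) = f x

/-- `X` is Ps-normal. -/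
def PsNormal (X : Type u) [TopologicalSpace X] : Prop :=
  ∃ (Y : Type u) (_ : TopologicalSpace Y) (f : X → Y), NormalSpace Y ∧
    Function.Bijective f ∧ ∀ K : Set X, IsPseudocompactSet K → RestrictsToHomeo f K

/-- `X` is CC-normal. -/
def CCNormal (X : Type u) [TopologicalSpace X] : Prop :=
  ∃ (Y : Type u) (_ : TopologicalSpace Y) (f : X → Y), NormalSpace Y ∧
    Function.Bijective f ∧ ∀ K : Set X, IsCountablyCompactSet K → RestrictsToHomeo f K

/-- `X` is C-normal. -/
def CNormal (X : Type u) [TopologicalSpace X] : Prop :=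
  ∃ (Y : Type u) (_ : TopologicalSpace Y) (f : X → Y), NormalSpace Y ∧
    Function.Bijective f ∧ ∀ K : Set X, IsCompact K → RestrictsToHomeo f K

/-- `X` is Ps-Tychonoff. -/
def PsTychonoff (X : Type u) [TopologicalSpace X] : Prop :=
  ∃ (Y : Type u) (_ : TopologicalSpace Y) (f : X → Y), T35Space Y ∧
    Function.Bijective f ∧ ∀ K : Set X, IsPseudocompactSet K → RestrictsToHomeo f K

/-- `X` is C-Tychonoff. -/
def CTychonoff (X : Type u) [TopologicalSpace X] : Prop :=
  ∃ (Y : Type u) (_ : TopologicalSpace Y) (f : X → Y), T35Space Y ∧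
    Function.Bijective f ∧ ∀ K : Set X, IsCompact K → RestrictsToHomeo f K

/-- `X` is L-Tychonoff. -/
def LTychonoff (X : Type u) [TopologicalSpace X] : Prop :=
  ∃ (Y : Type u) (_ : TopologicalSpace Y) (f : X → Y), T35Space Y ∧
    Function.Bijective f ∧ ∀ K : Set X, IsLindelof K → RestrictsToHomeo f K

theorem restrictsToHomeo_iff_isEmbedding {X : Type u} {Y : Type v} [TopologicalSpace X]
    [TopologicalSpace Y] {f : X → Y} {K : Set X} :
    RestrictsToHomeo f K ↔ IsEmbedding (K.domRestrict f) := by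
  constructor
  · rintro ⟨e, he⟩
    have hf : K.domRestrict f = Subtype.val ∘ e := funext fun x => (he x).symm
    rw [hf]
    exact IsEmbedding.subtypeVal.comp e.isEmbedding
  · intro h
    exact ⟨h.toHomeomorph.trans (Homeomorph.setCongr (Set.range_domRestrict f K)), fun _ => rfl⟩

theorem IsPseudocompactSet.image {X : Type u} {Y : Type v} [TopologicalSpace X]
    [TopologicalSpace Y] {K : Set X} (hK : IsPseudocompactSet K) {g : X → Y}
    (hg : Continuous g) : IsPseudocompactSet (g '' K) := by
  intro φ hφ
  obtain ⟨M, hM⟩ := hK (fun x => φ ⟨g x, mem_image_of_mem g x.2⟩)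
    (hφ.comp ((hg.comp continuous_subtype_val).subtype_mk _))
  refine ⟨M, ?_⟩
  rintro ⟨_, x, hx, rfl⟩
  exact hM ⟨x, hx⟩

/-- Ps-Tychonoffness is hereditary: every subspace of a Ps-Tychonoff space is
Ps-Tychonoff. -/
theorem psTychonoff_subtype {X : Type u} [TopologicalSpace X] (h : PsTychonoff X)
    (A : Set X) : PsTychonoff A := by
  obtain ⟨Y, _, f, _, hf, hK⟩ := h
  refine ⟨f '' A, inferInstance, fun x => ⟨f x, mem_image_of_mem f x.2⟩, inferInstance,
    ⟨fun x y hxy => Subtype.ext (hf.injective (Subtype.ext_iff.mp hxy)), ?_⟩, fun K hKp => ?_⟩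
  · rintro ⟨_, x, hx, rfl⟩
    exact ⟨⟨x, hx⟩, rfl⟩
  · have hemb := restrictsToHomeo_iff_isEmbedding.mp (hK _ (hKp.image continuous_subtype_val))
    have hincl : IsEmbedding fun x : K =>
        (⟨x.1, mem_image_of_mem Subtype.val x.2⟩ : (Subtype.val '' K : Set X)) :=
      .of_comp (g := Subtype.val) (by fun_prop) continuous_subtype_val
        ((IsEmbedding.subtypeVal (p := (· ∈ A))).comp (IsEmbedding.subtypeVal (p := (· ∈ K))))
    exact restrictsToHomeo_iff_isEmbedding.mpr <| .of_comp
      (((hemb.comp hincl).continuous).subtype_mk _) continuous_subtype_val (hemb.comp hincl)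
end

section
/- Let X be a Fréchet topological space, let Y be a normal Hausdorff (T2) topological space, and let f : X → Y be a bijection such that for every compact subset K of X the restriction f|_K : K → f(K) is a homeomorphism (i.e., f is a witness of C-normality of X). Then for any two disjoint compact subsets H and K of X there exists a continuous function h : X → [0,1] such that h(x) = 0 for all x ∈ H and h(x) = 1 for all x ∈ K. -/
open Set Topology Filter

universe u v

/-- A map restricting to a homeomorphism of `K` onto its image is continuous on `K`. -/
theorem RestrictsToHomeo.continuousOn {X : Type u} {Y : Type v} [TopologicalSpace X]
    [TopologicalSpace Y] {f : X → Y} {K : Set X} (h : RestrictsToHomeo f K) :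
    ContinuousOn f K := by
  obtain ⟨e, he⟩ := h
  rw [continuousOn_iff_continuous_domRestrict]
  exact (continuous_subtype_val.comp e.continuous).congr he

/-- A map from a sequential space that is continuous on every compact set is continuous. -/
theorem continuous_of_continuousOn_isCompact {X : Type u} {Y : Type v} [TopologicalSpace X]
    [TopologicalSpace Y] [SequentialSpace X] {f : X → Y}
    (h : ∀ K : Set X, IsCompact K → ContinuousOn f K) : Continuous f := by
  refine SeqContinuous.continuous fun u x hu => ?_
  refine (h _ hu.isCompact_insert_range x (mem_insert _ _)).tendsto.comp ?_
  exact tendsto_nhdsWithin_iff.2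
    ⟨hu, Eventually.of_forall fun n => mem_insert_of_mem _ (mem_range_self n)⟩

/-- If `f : X → Y` is a witness of C-normality of a Fréchet space `X` with `Y`
normal and Hausdorff, then disjoint compact subsets of `X` can be separated by a
continuous `[0,1]`-valued function. -/
theorem cNormal_witness_separation {X : Type u} {Y : Type v}
    [TopologicalSpace X] [TopologicalSpace Y] [FrechetUrysohnSpace X]
    [NormalSpace Y] [T2Space Y] (f : X → Y) (hf : Function.Bijective f)
    (hw : ∀ K : Set X, IsCompact K → RestrictsToHomeo f K)
    (H K : Set X) (hH : IsCompact H) (hK : IsCompact K) (hd : Disjoint H K) :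
    ∃ h : C(X, unitInterval), (∀ x ∈ H, h x = 0) ∧ ∀ x ∈ K, h x = 1 := by
  have hc : Continuous f :=
    continuous_of_continuousOn_isCompact fun K hK => (hw K hK).continuousOn
  obtain ⟨g, hg0, hg1, hg⟩ := exists_continuous_zero_one_of_isClosed
    (hH.image hc).isClosed (hK.image hc).isClosed ((disjoint_image_iff hf.injective).2 hd)
  exact ⟨⟨fun x => ⟨g (f x), hg (f x)⟩, (g.continuous.comp hc).subtype_mk _⟩,
    fun x hx => Subtype.ext (hg0 (mem_image_of_mem f hx)),
    fun x hx => Subtype.ext (hg1 (mem_image_of_mem f hx))⟩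
end
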